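/- Let ν ∈ L¹(ℝ^d, (1∧|h|^p)dh) be nonnegative, and let φ(t) = 1/w⁻¹(1/t) where w(r) = (r·ν^#(r))^{1/p} is assumed invertible. Suppose there exists Θ > 0 such that for every ball B ⊂ ℝ^d and all u ∈ L^φ(B), ‖u − ⨍_B u‖_{L^φ(B)} ≤ Θ (∬_{B×B} |u(x)−u(y)|^p ν(x−y) dy dx)^{1/p}. Then for all u ∈ L^φ(ℝ^d), ‖u‖_{L^φ(ℝ^d)} ≤ Θ (∬_{ℝ^d×ℝ^d} |u(x)−u(y)|^p ν(x−y) dy dx)^{1/p}. -/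

import Mathlib

open MeasureTheory ENNReal

/-- The Luxemburg norm of `u` in the Orlicz space associated with `φ` on measure `μ`. -/
noncomputable def luxNorm {α : Type*} [MeasurableSpace α] (μ : Measure α) (φ : ℝ → ℝ)
    (u : α → ℝ) : ℝ≥0∞ :=
  sInf {l : ℝ≥0∞ | 0 < l ∧ l ≠ ⊤ ∧ ∫⁻ x, ENNReal.ofReal (φ (|u x| / l.toReal)) ∂μ ≤ 1}

/-- The symmetric decreasing rearrangement (radial profile) of a kernel `ν` on `ℝ^d`. -/
noncomputable def symmRearr {d : ℕ} (ν : EuclideanSpace ℝ (Fin d) → ℝ≥0∞) (r : ℝ) : ℝ≥0∞ :=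
  sInf {s : ℝ≥0∞ | 0 < s ∧
    volume {h : EuclideanSpace ℝ (Fin d) | s < ν h} ≤
      volume (Metric.ball (0 : EuclideanSpace ℝ (Fin d)) 1) * ENNReal.ofReal (r ^ d)}

/-- `ν^#(r) = ∫_{{ν < ν*(η(r))}} ν(h) dh` with `η(r) = (r/c_d)^{1/d}`. -/
noncomputable def nuSharp {d : ℕ} (ν : EuclideanSpace ℝ (Fin d) → ℝ≥0∞) (r : ℝ) : ℝ≥0∞ :=
  ∫⁻ h in {h : EuclideanSpace ℝ (Fin d) |
      ν h < symmRearr ν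
        ((r / (volume (Metric.ball (0 : EuclideanSpace ℝ (Fin d)) 1)).toReal) ^ ((1 : ℝ) / d))},
    ν h

/-- `w(r) = (r ν^#(r))^{1/p}`. -/
noncomputable def wFn {d : ℕ} (ν : EuclideanSpace ℝ (Fin d) → ℝ≥0∞) (p r : ℝ) : ℝ :=
  (r * (nuSharp ν r).toReal) ^ (1 / p)

/-- The critical function `φ(t) = 1/w⁻¹(1/t)`. -/
noncomputable def critFn {d : ℕ} (ν : EuclideanSpace ℝ (Fin d) → ℝ≥0∞) (p t : ℝ) : ℝ :=
  1 / Function.invFunOn (wFn ν p) (Set.Ici 0) (1 / t)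

lemma ivp_aux (N : ℝ → ℝ) (hN : ∀ a b, 0 < a → a ≤ b → N b ≤ N a) (hpos : ∀ a, 0 < a → 0 < N a)
    (a b y : ℝ) (ha : 0 < a) (hab : a ≤ b) (h1 : a * N a < y) (h2 : y < b * N b) :
    ∃ s, a ≤ s ∧ s ≤ b ∧ s * N s = y := by
  set S : Set ℝ := {s | a ≤ s ∧ s ≤ b ∧ s * N s ≤ y} with hS
  have haS : a ∈ S := ⟨le_refl _, hab, h1.le⟩
  have hbd : BddAbove S := ⟨b, fun s hs => hs.2.1⟩
  set t := sSup S with ht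
  have hat : a ≤ t := le_csSup hbd haS
  have htb : t ≤ b := csSup_le ⟨a, haS⟩ (fun s hs => hs.2.1)
  have ht0 : 0 < t := lt_of_lt_of_le ha hat
  have hNt := hpos t ht0
  refine ⟨t, hat, htb, le_antisymm ?_ ?_⟩
  · by_contra hcon
    push Not at hcon
    have : y / N t < t := by rw [div_lt_iff₀ hNt]; exact hcon
    obtain ⟨s, hs, hs2⟩ := exists_lt_of_lt_csSup ⟨a, haS⟩ this
    have hst : s ≤ t := le_csSup hbd hs
    have hs0 : 0 < s := lt_of_lt_of_le ha hs.1
    have h3 := hN s t hs0 hst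
    rw [div_lt_iff₀ hNt] at hs2
    have := hs.2.2
    nlinarith
  · by_contra hcon
    push Not at hcon
    have h4 : t < y / N t := by rw [lt_div_iff₀ hNt]; exact hcon
    have htb' : t < b := by
      rcases lt_or_eq_of_le htb with h | h
      · exact h
      · rw [h] at hcon; linarith
    set s := min b (y / N t) with hs
    have hts : t < s := lt_min htb' h4
    have hsy : s * N t ≤ y := by
      rw [← le_div_iff₀ hNt]; exact min_le_right _ _
    have hs0 : 0 < s := ht0.trans hts
    have h3 := hN t s ht0 hts.le
    have : s ∈ S := ⟨hat.trans hts.le, min_le_left _ _, by nlinarith⟩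
    exact absurd (le_csSup hbd this) (not_le.mpr hts)

lemma symmRearr_anti {d : ℕ} (ν : EuclideanSpace ℝ (Fin d) → ℝ≥0∞) {a b : ℝ} (ha : 0 ≤ a)
    (hab : a ≤ b) : symmRearr ν b ≤ symmRearr ν a := by
  unfold symmRearr
  apply sInf_le_sInf
  rintro s ⟨h1, h2⟩
  refine ⟨h1, h2.trans ?_⟩
  gcongr

lemma nuSharp_anti {d : ℕ} (ν : EuclideanSpace ℝ (Fin d) → ℝ≥0∞) {a b : ℝ} (ha : 0 ≤ a)
    (hab : a ≤ b) : nuSharp ν b ≤ nuSharp ν a := by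
  unfold nuSharp
  apply lintegral_mono_set
  intro h hh
  refine lt_of_lt_of_le hh (symmRearr_anti ν (by positivity) ?_)
  gcongr

lemma nuSharp_le {d : ℕ} (hd : 1 ≤ d) (ν : EuclideanSpace ℝ (Fin d) → ℝ≥0∞) (hν : Measurable ν)
    (ρ r : ℝ) (hr : 0 < r)
    (hρ : ρ = (r / (volume (Metric.ball (0 : EuclideanSpace ℝ (Fin d)) 1)).toReal) ^ ((1 : ℝ) / d)) :
    nuSharp ν r ≤ ∫⁻ h in (Metric.ball (0 : EuclideanSpace ℝ (Fin d)) ρ)ᶜ, ν h := by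
  have : Nonempty (Fin d) := ⟨⟨0, hd⟩⟩
  unfold nuSharp
  rw [← hρ]
  have hρ0 : 0 ≤ ρ := by rw [hρ]; positivity
  set T := symmRearr ν ρ with hT
  have hB : volume (Metric.ball (0 : EuclideanSpace ℝ (Fin d)) ρ) =
      volume (Metric.ball (0 : EuclideanSpace ℝ (Fin d)) 1) * ENNReal.ofReal (ρ ^ d) := by
    rw [Measure.addHaar_ball _ _ hρ0, mul_comm]; simp
  have key : ∀ σ : ℝ≥0∞, 0 < σ → σ < T → ∫⁻ h in {h | ν h ≤ σ}, ν h ≤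
      ∫⁻ h in (Metric.ball (0 : EuclideanSpace ℝ (Fin d)) ρ)ᶜ, ν h := by
    intro σ h0 hσ
    set B := Metric.ball (0 : EuclideanSpace ℝ (Fin d)) ρ with hBdef
    have hBm : MeasurableSet B := measurableSet_ball
    set A := {h | ν h ≤ σ} with hA
    have hAm : MeasurableSet A := measurableSet_le hν measurable_const
    have hAc : Aᶜ = {h | σ < ν h} := by ext; simp [hA]
    have h1 : volume B ≤ volume Aᶜ := by
      by_contra hcon
      push Not at hcon
      rw [hB, hAc] at hcon
      have : T ≤ σ := sInf_le ⟨h0, hcon.le⟩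
      exact absurd this (not_le.mpr hσ)
    have h2 : volume (A ∩ B) ≤ volume (Aᶜ ∩ Bᶜ) := by
      have e1 : volume B = volume (B ∩ A) + volume (B \ A) := (measure_inter_add_sdiff B hAm).symm
      have e2 : volume Aᶜ = volume (Aᶜ ∩ B) + volume (Aᶜ \ B) :=
        (measure_inter_add_sdiff Aᶜ hBm).symm
      have e3 : B \ A = Aᶜ ∩ B := by ext; simp [and_comm]
      rw [e1, e2, e3, add_comm] at h1
      have hfin : volume (Aᶜ ∩ B) ≠ ⊤ :=
        ((measure_mono Set.inter_subset_right).trans_lt measure_ball_lt_top).ne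
      have := (ENNReal.add_le_add_iff_left hfin).1 h1
      rwa [Set.inter_comm, ← Set.sdiff_eq]
    calc ∫⁻ h in A, ν h = (∫⁻ h in A ∩ B, ν h) + ∫⁻ h in A \ B, ν h :=
          (lintegral_inter_add_sdiff _ A hBm).symm
      _ ≤ (∫⁻ h in Aᶜ ∩ Bᶜ, ν h) + ∫⁻ h in A \ B, ν h := by
          gcongr ?_ + _
          calc ∫⁻ h in A ∩ B, ν h ≤ ∫⁻ h in A ∩ B, σ :=
                setLIntegral_mono measurable_const (fun x hx => hx.1)
            _ = σ * volume (A ∩ B) := by simp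
            _ ≤ σ * volume (Aᶜ ∩ Bᶜ) := by gcongr
            _ = ∫⁻ h in Aᶜ ∩ Bᶜ, σ := by simp
            _ ≤ ∫⁻ h in Aᶜ ∩ Bᶜ, ν h := 
                setLIntegral_mono hν (fun x hx => by
                  have := hx.1; rw [hAc] at this; exact (show σ < ν x from this).le)
      _ = ∫⁻ h in Bᶜ, ν h := by
          rw [add_comm, ← lintegral_inter_add_sdiff _ Bᶜ hAm]
          congr 2
          · congr 1; ext; simp [and_comm]
          · congr 1; ext; simp [and_comm]
  rcases eq_or_ne T 0 with h0 | h0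
  · simp [h0]
  obtain ⟨σ, hmono, hmem, hlim⟩ := exists_seq_strictMono_tendsto' (pos_iff_ne_zero.mpr h0)
  have hU : {h | ν h < T} = ⋃ n, {h | ν h ≤ σ n} := by
    ext h
    simp only [Set.mem_ofPred_eq, Set.mem_iUnion]
    constructor
    · intro hh
      obtain ⟨n, hn⟩ := (hlim.eventually (lt_mem_nhds hh)).exists
      exact ⟨n, hn.le⟩
    · rintro ⟨n, hn⟩
      exact hn.trans_lt (hmem n).2
  rw [hU, setLIntegral_iUnion_of_directed]
  · exact iSup_le fun n => key _ (hmem n).1 (hmem n).2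
  · apply Monotone.directed_le
    intro m n hmn h hh
    exact le_trans (show ν h ≤ σ m from hh) (hmono.monotone hmn)

/-- Packaged facts about the critical function. -/
structure CritData (φ N : ℝ → ℝ) (p : ℝ) : Prop where
  anti : ∀ a b, 0 < a → a ≤ b → N b ≤ N a
  pos : ∀ a, 0 < a → 0 < N a
  inj : ∀ a b, 0 < a → 0 < b → a * N a = b * N b → a = b
  zero : φ 0 = 0
  rep : ∀ t, 0 < t → ∃ s, 0 < s ∧ φ t = 1 / s ∧ t ^ p * (s * N s) = 1

lemma critData {d : ℕ} (p : ℝ) (hp : 1 ≤ p)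
    (ν : EuclideanSpace ℝ (Fin d) → ℝ≥0∞)
    (hw : Set.BijOn (wFn ν p) (Set.Ici 0) (Set.Ici 0)) :
    CritData (critFn ν p) (fun r => (nuSharp ν r).toReal) p := by
  have hp0 : 0 < p := by linarith
  have hw0 : wFn ν p 0 = 0 := by
    simp [wFn, hp0.ne']
  have hpos : ∀ a, 0 < a → 0 < (nuSharp ν a).toReal := by
    intro a ha
    refine lt_of_le_of_ne ENNReal.toReal_nonneg fun h => ?_
    have : wFn ν p a = wFn ν p 0 := by rw [hw0]; simp [wFn, ← h, hp0.ne']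
    exact ha.ne' (hw.injOn (Set.mem_Ici.2 ha.le) (Set.mem_Ici.2 le_rfl) this)
  refine ⟨?_, hpos, ?_, ?_, ?_⟩
  · intro a b ha hab
    exact ENNReal.toReal_mono (ENNReal.toReal_pos_iff.1 (hpos a ha)).2.ne (nuSharp_anti ν ha.le hab)
  · intro a b ha hb h
    apply hw.injOn (Set.mem_Ici.2 ha.le) (Set.mem_Ici.2 hb.le)
    simp only [wFn]
    rw [h]
  · have h1 : (0:ℝ) ∈ wFn ν p '' Set.Ici 0 := ⟨0, Set.mem_Ici.2 le_rfl, hw0⟩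
    have h2 := Function.invFunOn_mem h1
    have h3 := Function.invFunOn_eq h1
    have : Function.invFunOn (wFn ν p) (Set.Ici 0) 0 = 0 :=
      hw.injOn h2 (Set.mem_Ici.2 le_rfl) (h3.trans hw0.symm)
    simp [critFn, this]
  · intro t ht
    have h1 : (1 / t) ∈ wFn ν p '' Set.Ici 0 :=
      hw.surjOn (Set.mem_Ici.2 (by positivity))
    have h2 := Function.invFunOn_mem h1
    have h3 := Function.invFunOn_eq h1
    set s := Function.invFunOn (wFn ν p) (Set.Ici 0) (1 / t) with hs
    have hs0 : 0 < s := by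
      refine lt_of_le_of_ne h2 fun h => ?_
      rw [← h, hw0] at h3
      have : 0 < 1 / t := by positivity
      linarith
    refine ⟨s, hs0, rfl, ?_⟩
    have h4 : 0 < s * (nuSharp ν s).toReal := mul_pos hs0 (hpos s hs0)
    have h5 : s * (nuSharp ν s).toReal = (1 / t) ^ p := by
      rw [← h3, wFn, ← Real.rpow_mul h4.le]
      simp [hp0.ne']
    rw [h5, ← Real.mul_rpow ht.le (by positivity)]
    simp [ht.ne']

lemma CritData.phi_pos {φ N : ℝ → ℝ} {p : ℝ} (D : CritData φ N p) {t : ℝ} (ht : 0 < t) :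
    0 < φ t := by
  obtain ⟨s, hs, h, -⟩ := D.rep t ht
  rw [h]; positivity

lemma CritData.ratio {φ N : ℝ → ℝ} {p : ℝ} (hp : 1 ≤ p) (D : CritData φ N p)
    (hm : ∀ a b, 0 < a → a < b → a * N a < b * N b) :
    ∀ t₁ t₂, 0 < t₁ → t₁ ≤ t₂ → φ t₁ * t₂ ≤ φ t₂ * t₁ := by
  intro t₁ t₂ h1 h12
  have hp0 : 0 < p := by linarith
  have h2 : 0 < t₂ := h1.trans_le h12
  obtain ⟨s₁, hs1, e1, f1⟩ := D.rep t₁ h1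
  obtain ⟨s₂, hs2, e2, f2⟩ := D.rep t₂ h2
  have hs : s₂ ≤ s₁ := by
    by_contra hcon
    push Not at hcon
    have h3 := hm s₁ s₂ hs1 hcon
    have h4 : t₁ ^ p ≤ t₂ ^ p := Real.rpow_le_rpow h1.le h12 hp0.le
    have h5 : 0 < t₂ ^ p := Real.rpow_pos_of_pos h2 p
    have h6 : 0 < s₁ * N s₁ := mul_pos hs1 (D.pos s₁ hs1)
    nlinarith
  have hN := D.anti s₂ s₁ hs2 hs
  have hN1 := D.pos s₁ hs1
  have k1 : t₂ ^ p * s₂ ≤ t₁ ^ p * s₁ := by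
    have h5 : 0 < t₂ ^ p * s₂ := mul_pos (Real.rpow_pos_of_pos h2 p) hs2
    have : (t₂ ^ p * s₂) * N s₁ ≤ (t₁ ^ p * s₁) * N s₁ := by
      nlinarith
    exact le_of_mul_le_mul_right this hN1
  have k2 : s₂ ^ (p - 1) ≤ s₁ ^ (p - 1) := Real.rpow_le_rpow hs2.le hs (by linarith)
  have k3 : ∀ t s : ℝ, 0 < t → 0 < s → (t * s) ^ p = (t ^ p * s) * s ^ (p - 1) := by
    intro t s ht hs
    rw [Real.mul_rpow ht.le hs.le, mul_assoc, ← Real.rpow_one_add' hs.le (by linarith)]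
    congr 2; ring
  have k4 : (t₂ * s₂) ^ p ≤ (t₁ * s₁) ^ p := by
    rw [k3 _ _ h2 hs2, k3 _ _ h1 hs1]
    have : 0 < t₁ ^ p := Real.rpow_pos_of_pos h1 p
    gcongr
  have k5 : t₂ * s₂ ≤ t₁ * s₁ := (Real.rpow_le_rpow_iff (by positivity) (by positivity) hp0).1 k4
  rw [e1, e2, div_mul_eq_mul_div, div_mul_eq_mul_div, div_le_div_iff₀ hs1 hs2]
  linarith

lemma luxNorm_restrict_le {α : Type*} [MeasurableSpace α] (μ : Measure α) (s : Set α) (φ : ℝ → ℝ)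
    (u : α → ℝ) : luxNorm (μ.restrict s) φ u ≤ luxNorm μ φ u := by
  unfold luxNorm
  apply sInf_le_sInf
  rintro l ⟨h1, h2, h3⟩
  exact ⟨h1, h2, (lintegral_mono' Measure.restrict_le_self le_rfl).trans h3⟩

/-- averages over large balls tend to zero -/
lemma average_tendsto {d : ℕ} (hd : 1 ≤ d) (φ : ℝ → ℝ) (hpos : ∀ t, 0 < t → 0 < φ t)
    (hφ0 : φ 0 = 0)
    (hr : ∀ t₁ t₂, 0 < t₁ → t₁ ≤ t₂ → φ t₁ * t₂ ≤ φ t₂ * t₁)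
    (u : EuclideanSpace ℝ (Fin d) → ℝ) (lam : ℝ) (hl : 0 < lam)
    (hu : ∫⁻ x, ENNReal.ofReal (φ (|u x| / lam)) ≤ 1) :
    Filter.Tendsto (fun n : ℕ => ⨍ y in Metric.ball (0 : EuclideanSpace ℝ (Fin d)) (n + 1 : ℝ), u y)
      Filter.atTop (nhds 0) := by
  have : Nonempty (Fin d) := ⟨⟨0, hd⟩⟩
  have hφn : ∀ t, 0 ≤ t → 0 ≤ φ t := by
    intro t ht
    rcases ht.eq_or_lt with h | h
    · rw [← h, hφ0]
    · exact (hpos t h).le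
  have hbound : ∀ ε : ℝ, 0 < ε → ∀ n : ℕ,
      |⨍ y in Metric.ball (0 : EuclideanSpace ℝ (Fin d)) (n + 1 : ℝ), u y| ≤
        lam * ε + (lam * ε / φ ε) *
          (volume.real (Metric.ball (0 : EuclideanSpace ℝ (Fin d)) (n + 1 : ℝ)))⁻¹ := by
    intro ε hε n
    have hφε := hpos ε hε
    set B := Metric.ball (0 : EuclideanSpace ℝ (Fin d)) (n + 1 : ℝ) with hB
    have hBfin : volume B ≠ ⊤ := measure_ball_lt_top.ne
    have hBpos : 0 < volume B := Metric.measure_ball_pos _ _ (by positivity)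
    have hV : 0 < volume.real B := ENNReal.toReal_pos hBpos.ne' hBfin
    have hpt : ∀ x, |u x| ≤ lam * ε + (lam * ε / φ ε) * φ (|u x| / lam) := by
      intro x
      have hn : 0 ≤ (lam * ε / φ ε) * φ (|u x| / lam) :=
        mul_nonneg (by positivity) (hφn _ (by positivity))
      rcases le_total (|u x| / lam) ε with h | h
      · rw [div_le_iff₀ hl] at h
        nlinarith
      · have h1 := hr ε _ hε h
        have : |u x| ≤ (lam * ε / φ ε) * φ (|u x| / lam) := by
          rw [div_mul_eq_mul_div, le_div_iff₀ hφε]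
          have h2 : φ ε * (|u x| / lam) * lam = φ ε * |u x| := by field_simp
          nlinarith
        have : 0 < lam * ε := by positivity
        linarith
    have hint : ENNReal.ofReal |∫ y in B, u y| ≤
        ENNReal.ofReal (lam * ε * volume.real B + lam * ε / φ ε) := by
      calc ENNReal.ofReal |∫ y in B, u y| = ‖∫ y in B, u y‖ₑ := (Real.enorm_eq_ofReal_abs _).symm
        _ ≤ ∫⁻ y in B, ‖u y‖ₑ := enorm_integral_le_lintegral_enorm _
        _ ≤ ∫⁻ y in B, (ENNReal.ofReal (lam * ε) + ENNReal.ofReal (lam * ε / φ ε) *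
              ENNReal.ofReal (φ (|u y| / lam))) := by
            apply lintegral_mono
            intro y
            simp only
            rw [Real.enorm_eq_ofReal_abs, ← ENNReal.ofReal_mul (by positivity),
              ← ENNReal.ofReal_add (by positivity)
                (mul_nonneg (by positivity) (hφn _ (by positivity)))]
            exact ENNReal.ofReal_le_ofReal (hpt y)
        _ = ENNReal.ofReal (lam * ε) * volume B + ENNReal.ofReal (lam * ε / φ ε) *
              ∫⁻ y in B, ENNReal.ofReal (φ (|u y| / lam)) := by
            rw [lintegral_add_left measurable_const, lintegral_const_mul' _ _ ENNReal.ofReal_ne_top]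
            simp
        _ ≤ ENNReal.ofReal (lam * ε) * volume B + ENNReal.ofReal (lam * ε / φ ε) * 1 := by
            gcongr
            exact (lintegral_mono' Measure.restrict_le_self le_rfl).trans hu
        _ = _ := by
            rw [mul_one, ENNReal.ofReal_add (by positivity) (by positivity),
              ENNReal.ofReal_mul (p := lam * ε) (by positivity), Measure.real, ENNReal.ofReal_toReal hBfin]
    have hint' := (ENNReal.ofReal_le_ofReal_iff (by positivity)).1 hint
    rw [setAverage_eq, smul_eq_mul, abs_mul, abs_of_pos (inv_pos.2 hV)]
    calc (volume.real B)⁻¹ * |∫ y in B, u y| ≤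
          (volume.real B)⁻¹ * (lam * ε * volume.real B + lam * ε / φ ε) := by gcongr
      _ = _ := by field_simp
  have hVol : Filter.Tendsto (fun n : ℕ =>
      (volume.real (Metric.ball (0 : EuclideanSpace ℝ (Fin d)) (n + 1 : ℝ)))⁻¹)
      Filter.atTop (nhds 0) := by
    apply Filter.Tendsto.inv_tendsto_atTop
    set c := volume.real (Metric.ball (0 : EuclideanSpace ℝ (Fin d)) 1) with hc
    have hc0 : 0 < c := ENNReal.toReal_pos (Metric.measure_ball_pos _ _ (by positivity)).ne'
      measure_ball_lt_top.ne
    have h1 : Filter.Tendsto (fun n : ℕ => (n : ℝ) * c) Filter.atTop Filter.atTop :=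
      tendsto_natCast_atTop_atTop.atTop_mul_const hc0
    refine Filter.tendsto_atTop_mono (fun n => ?_) h1
    have : volume.real (Metric.ball (0 : EuclideanSpace ℝ (Fin d)) (n + 1 : ℝ)) =
        ((n : ℝ) + 1) ^ d * c := by
      rw [Measure.real, Measure.addHaar_ball _ _ (by positivity), ENNReal.toReal_mul,
        ENNReal.toReal_ofReal (by positivity)]
      simp [hc, Measure.real]
    rw [this]
    gcongr
    calc (n : ℝ) ≤ (n : ℝ) + 1 := by linarith
      _ ≤ ((n : ℝ) + 1) ^ d := le_self_pow₀ (by linarith [Nat.cast_nonneg (α := ℝ) n]) (by omega)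
  rw [Metric.tendsto_atTop']
  intro ε hε
  set e := ε / (2 * lam) with he
  have he0 : 0 < e := by positivity
  have h2 := hVol.const_mul (lam * e / φ e)
  rw [mul_zero] at h2
  obtain ⟨M, hM⟩ := Filter.eventually_atTop.1 (h2.eventually (gt_mem_nhds (half_pos hε)))
  refine ⟨M, fun n hn => ?_⟩
  rw [Real.dist_eq, sub_zero]
  have h3 := hbound e he0 n
  have h4 := hM n hn.le
  have h5 : lam * e = ε / 2 := by rw [he]; field_simp
  linarith

lemma case_mono {d : ℕ} (hd : 1 ≤ d) (p : ℝ) (hp : 1 ≤ p)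
    (ν : EuclideanSpace ℝ (Fin d) → ℝ≥0∞) (φ : ℝ → ℝ) (hpos : ∀ t, 0 < t → 0 < φ t)
    (hφ0 : φ 0 = 0)
    (hr : ∀ t₁ t₂, 0 < t₁ → t₁ ≤ t₂ → φ t₁ * t₂ ≤ φ t₂ * t₁)
    (Θ : ℝ)
    (u : EuclideanSpace ℝ (Fin d) → ℝ) (hu : Measurable u)
    (hPS : ∀ (z : EuclideanSpace ℝ (Fin d)) (r : ℝ), 0 < r →
        luxNorm (volume.restrict (Metric.ball z r)) φ u ≠ ⊤ →
        luxNorm (volume.restrict (Metric.ball z r)) φ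
            (fun x => u x - ⨍ y in Metric.ball z r, u y) ≤
          ENNReal.ofReal Θ *
            (∫⁻ x in Metric.ball z r, ∫⁻ y in Metric.ball z r,
                ENNReal.ofReal (|u x - u y| ^ p) * ν (x - y)) ^ (1 / p))
    (hfin : luxNorm volume φ u ≠ ⊤) :
      luxNorm volume φ u ≤
        ENNReal.ofReal Θ *
          (∫⁻ x, ∫⁻ y, ENNReal.ofReal (|u x - u y| ^ p) * ν (x - y)) ^ (1 / p) := by
  have hp0 : 0 < p := by linarith
  have hφn : ∀ t, 0 ≤ t → 0 ≤ φ t := by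
    intro t ht
    rcases ht.eq_or_lt with h | h
    · rw [← h, hφ0]
    · exact (hpos t h).le
  have hmono : ∀ a b, 0 ≤ a → a ≤ b → φ a ≤ φ b := by
    intro a b ha hab
    rcases ha.eq_or_lt with h | h
    · rw [← h, hφ0]; exact hφn b (ha.trans hab)
    · have h1 := hr a b h hab
      have h2 := hpos a h
      have h3 : φ a * a ≤ φ b * a := by nlinarith
      exact le_of_mul_le_mul_right h3 h
  have hmeas : Measurable (fun t => φ (max t 0)) := by
    apply Monotone.measurable
    intro a b hab
    exact hmono _ _ (le_max_right _ _) (max_le_max_right _ hab)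
  obtain ⟨lam, hlam⟩ : ∃ l : ℝ≥0∞, 0 < l ∧ l ≠ ⊤ ∧
      ∫⁻ x, ENNReal.ofReal (φ (|u x| / l.toReal)) ≤ 1 := by
    by_contra hcon
    apply hfin
    unfold luxNorm
    rw [sInf_eq_top]
    intro l hl
    exact absurd ⟨l, hl⟩ hcon
  have hlim := average_tendsto hd φ hpos hφ0 hr u lam.toReal
    (ENNReal.toReal_pos hlam.1.ne' hlam.2.1) hlam.2.2
  set a : ℕ → ℝ := fun n => ⨍ y in Metric.ball (0 : EuclideanSpace ℝ (Fin d)) (n + 1 : ℝ), u y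
    with ha
  set L := ENNReal.ofReal Θ *
          (∫⁻ x, ∫⁻ y, ENNReal.ofReal (|u x - u y| ^ p) * ν (x - y)) ^ (1 / p) with hL
  have hball : ∀ n : ℕ, luxNorm (volume.restrict
      (Metric.ball (0 : EuclideanSpace ℝ (Fin d)) (n + 1 : ℝ))) φ (fun x => u x - a n) ≤ L := by
    intro n
    refine (hPS 0 (n + 1) (by positivity)
      (ne_top_of_le_ne_top hfin (luxNorm_restrict_le _ _ _ _))).trans ?_
    rw [hL]
    refine mul_le_mul' le_rfl (ENNReal.rpow_le_rpow ?_ (by positivity))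
    refine lintegral_mono' Measure.restrict_le_self ?_
    intro x
    exact lintegral_mono' Measure.restrict_le_self le_rfl
  refine le_of_forall_gt_imp_ge_of_dense ?_
  intro l hl
  rcases eq_or_ne l ⊤ with hltop | hltop
  · rw [hltop]; exact le_top
  obtain ⟨m, hLm, hml⟩ := exists_between hl
  have hm0 : 0 < m := pos_of_gt hLm
  have hl0 : 0 < l := pos_of_gt hl
  have hmtop : m ≠ ⊤ := (hml.trans_le le_top).ne
  have hmr : 0 < m.toReal := ENNReal.toReal_pos hm0.ne' hmtop
  have hmlr : m.toReal < l.toReal := (ENNReal.toReal_lt_toReal hmtop hltop).2 hml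
  have hone : ∀ n : ℕ, ∫⁻ x in Metric.ball (0 : EuclideanSpace ℝ (Fin d)) (n + 1 : ℝ),
      ENNReal.ofReal (φ (|u x - a n| / m.toReal)) ≤ 1 := by
    intro n
    obtain ⟨k, ⟨hk0, hktop, hk⟩, hkm⟩ := sInf_lt_iff.1 ((hball n).trans_lt hLm)
    refine le_trans (lintegral_mono fun x => ?_) hk
    apply ENNReal.ofReal_le_ofReal
    apply hmono _ _ (by positivity)
    have : 0 < k.toReal := ENNReal.toReal_pos hk0.ne' hktop
    have : k.toReal ≤ m.toReal := ENNReal.toReal_mono hmtop hkm.le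
    gcongr
  apply sInf_le
  refine ⟨hl0, hltop, ?_⟩
  set F : ℕ → EuclideanSpace ℝ (Fin d) → ℝ≥0∞ := fun n =>
    (Metric.ball (0 : EuclideanSpace ℝ (Fin d)) (n + 1 : ℝ)).indicator
      (fun x => ENNReal.ofReal (φ (|u x - a n| / m.toReal))) with hF
  have hFm : ∀ n, Measurable (F n) := by
    intro n
    refine Measurable.indicator ?_ measurableSet_ball
    have h1 : Measurable (fun x => |u x - a n| / m.toReal) := by fun_prop
    have h2 := (hmeas.comp h1).ennreal_ofReal
    convert h2 using 2 with x
    have : max (|u x - a n| / m.toReal) 0 = |u x - a n| / m.toReal := max_eq_left (by positivity)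
    simp only [Function.comp, this]
  calc ∫⁻ x, ENNReal.ofReal (φ (|u x| / l.toReal)) ≤
        ∫⁻ x, Filter.liminf (fun n => F n x) Filter.atTop := by
        apply lintegral_mono
        intro x
        rcases eq_or_ne (u x) 0 with h | h
        · simp [h, hφ0]
        apply Filter.le_liminf_of_le
        · isBoundedDefault
        have hux : 0 < |u x| := abs_pos.2 h
        have h1 : Filter.Tendsto (fun n => |u x - a n| / m.toReal) Filter.atTop
            (nhds (|u x - 0| / m.toReal)) := ((tendsto_const_nhds.sub hlim).abs).div_const _
        rw [sub_zero] at h1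
        have h2 : |u x| / l.toReal < |u x| / m.toReal := by gcongr
        filter_upwards [h1.eventually (lt_mem_nhds h2),
          Filter.eventually_ge_atTop (⌈‖x‖⌉₊)] with n hn hn2
        have hx : x ∈ Metric.ball (0 : EuclideanSpace ℝ (Fin d)) (n + 1 : ℝ) := by
          rw [mem_ball_zero_iff]
          have h3 : ‖x‖ ≤ ⌈‖x‖⌉₊ := Nat.le_ceil _
          have h4 : ((⌈‖x‖⌉₊ : ℕ) : ℝ) ≤ n := by exact_mod_cast hn2
          linarith
        simp only [hF]
        rw [Set.indicator_of_mem hx]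
        exact ENNReal.ofReal_le_ofReal (hmono _ _ (by positivity) hn.le)
    _ ≤ Filter.liminf (fun n => ∫⁻ x, F n x) Filter.atTop := lintegral_liminf_le hFm
    _ ≤ 1 := by
        apply Filter.liminf_le_of_le
        · isBoundedDefault
        intro b hb
        obtain ⟨n, hn⟩ := hb.exists
        refine hn.trans ?_
        simp only [hF]
        rw [lintegral_indicator measurableSet_ball]
        exact hone n

/-- In the non-monotone case `φ(t) t^d → ∞` as `t → 0`. -/
lemma CritData.blowup {φ N : ℝ → ℝ} {p : ℝ} (hp : 1 ≤ p) (D : CritData φ N p)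
    (x x' : ℝ) (hx : 0 < x) (hxx : x < x') (hg : x' * N x' < x * N x)
    {d : ℕ} (hd : 1 ≤ d) (c C : ℝ) (hc : 0 < c) (hC : 0 < C)
    (hN : ∀ s ρ, 0 < s → ρ = (s / c) ^ ((1 : ℝ) / d) → ρ ≤ 1 → N s * ρ ^ p ≤ C)
    (K : ℝ) (hK : 0 < K) : ∃ δ > 0, ∀ t, 0 < t → t < δ → K ≤ t ^ d * φ t := by
  have hp0 : 0 < p := by linarith
  set Q := max 1 (c * K) with hQ
  have hQ1 : 1 ≤ Q := le_max_left _ _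
  -- `g` is bounded on `[ε, ∞)`
  set ε := min x (min c (1 / (C * Q ^ p))) with hε
  have hQp : 0 < Q ^ p := Real.rpow_pos_of_pos (by linarith) p
  have hε0 : 0 < ε := by positivity
  set M := max (x * N x) (x' * N ε) with hM
  have hM0 : 0 < M := lt_max_of_lt_left (mul_pos hx (D.pos x hx))
  have hbd : ∀ s, ε ≤ s → s * N s ≤ M := by
    intro s hs
    have hs0 : 0 < s := hε0.trans_le hs
    rcases le_total s x' with h | h
    · refine le_trans ?_ (le_max_right _ _)
      have := D.anti ε s hε0 hs
      have := D.pos s hs0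
      have : 0 < x' := hx.trans hxx
      gcongr
    · refine le_trans ?_ (le_max_left _ _)
      by_contra hcon
      push Not at hcon
      obtain ⟨q, hq1, hq2, hq3⟩ := ivp_aux N D.anti D.pos x' s (x * N x) (hx.trans hxx) h hg hcon
      have := D.inj q x (by linarith) hx hq3
      linarith
  refine ⟨M ^ (-(1 / p)), Real.rpow_pos_of_pos hM0 _, ?_⟩
  intro t ht htδ
  obtain ⟨s, hs0, hφ, hts⟩ := D.rep t ht
  have htp : 0 < t ^ p := Real.rpow_pos_of_pos ht p
  have hsε : s < ε := by
    by_contra hcon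
    push Not at hcon
    have h1 := hbd s hcon
    have h2 : t ^ p < (M ^ (-(1 / p))) ^ p := Real.rpow_lt_rpow ht.le htδ hp0
    rw [← Real.rpow_mul hM0.le] at h2
    have h3 : -(1 / p) * p = -1 := by field_simp
    rw [h3, Real.rpow_neg_one] at h2
    have h4 : t ^ p * M < 1 := by
      have := mul_lt_mul_of_pos_right h2 hM0
      rwa [inv_mul_cancel₀ hM0.ne'] at this
    nlinarith
  set ρ := (s / c) ^ ((1 : ℝ) / d) with hρ
  have hρ0 : 0 < ρ := Real.rpow_pos_of_pos (by positivity) _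
  have hsc : s < c := hsε.trans_le ((min_le_right _ _).trans (min_le_left _ _))
  have hρ1 : ρ ≤ 1 := Real.rpow_le_one (by positivity) (by rw [div_le_one hc]; exact hsc.le)
    (by positivity)
  have hρd : ρ ^ d = s / c := by
    rw [hρ, ← Real.rpow_natCast, ← Real.rpow_mul (by positivity)]
    have : (d : ℝ) ≠ 0 := by positivity
    rw [one_div_mul_cancel this, Real.rpow_one]
  have h1 := hN s ρ hs0 hρ hρ1
  have hρp : 0 < ρ ^ p := Real.rpow_pos_of_pos hρ0 p
  have hsQ : s * (C * Q ^ p) ≤ 1 := by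
    have : s ≤ 1 / (C * Q ^ p) := hsε.le.trans ((min_le_right _ _).trans (min_le_right _ _))
    rwa [le_div_iff₀ (by positivity)] at this
  -- `Q ρ ≤ t`
  have h2 : ρ ^ p ≤ t ^ p * s * C := by
    have : ρ ^ p = t ^ p * s * (N s * ρ ^ p) := by
      calc ρ ^ p = (t ^ p * (s * N s)) * ρ ^ p := by rw [hts, one_mul]
        _ = _ := by ring
    rw [this]
    gcongr
  have h3 : (Q * ρ) ^ p ≤ t ^ p := by
    rw [Real.mul_rpow (by linarith) hρ0.le]
    calc Q ^ p * ρ ^ p ≤ Q ^ p * (t ^ p * s * C) := by gcongr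
      _ = t ^ p * (s * (C * Q ^ p)) := by ring
      _ ≤ t ^ p * 1 := by gcongr
      _ = t ^ p := mul_one _
  have h4 : Q * ρ ≤ t := (Real.rpow_le_rpow_iff (by positivity) ht.le hp0).1 h3
  have h5 : Q ≤ Q ^ d := le_self_pow₀ hQ1 (by omega)
  have h6 : (Q * ρ) ^ d ≤ t ^ d := pow_le_pow_left₀ (by positivity) h4 d
  rw [mul_pow, hρd] at h6
  have h7 : c * K ≤ Q := le_max_right _ _
  rw [hφ, mul_one_div, le_div_iff₀ hs0]
  calc K * s = (c * K) * (s / c) := by field_simp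
    _ ≤ Q ^ d * (s / c) := by gcongr; linarith
    _ ≤ t ^ d := h6

/-- In the non-monotone case `φ` is small at infinity. -/
lemma CritData.decay {φ N : ℝ → ℝ} {p : ℝ} (hp : 1 ≤ p) (D : CritData φ N p)
    (x x' : ℝ) (hx : 0 < x) (hxx : x < x') (hg : x' * N x' < x * N x)
    (S : ℝ) (hS : 0 < S) : ∃ T > 0, ∀ t, T < t → φ t ≤ 1 / S := by
  have hp0 : 0 < p := by linarith
  have hx' : 0 < x' := hx.trans hxx
  set m := min (x' * N x') (x * N S) with hm
  have hm0 : 0 < m := lt_min (mul_pos hx' (D.pos x' hx')) (mul_pos hx (D.pos S hS))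
  have hbd : ∀ s, 0 < s → s ≤ S → m ≤ s * N s := by
    intro s hs hsS
    rcases le_total x s with h | h
    · refine le_trans (min_le_right _ _) ?_
      have := D.anti s S hs hsS
      have := D.pos S hS
      gcongr
    · refine le_trans (min_le_left _ _) ?_
      by_contra hcon
      push Not at hcon
      obtain ⟨q, hq1, hq2, hq3⟩ := ivp_aux N D.anti D.pos s x (x' * N x') hs h hcon hg
      have := D.inj q x' (by linarith) hx' hq3
      linarith
  refine ⟨m ^ (-(1 / p)), Real.rpow_pos_of_pos hm0 _, ?_⟩
  intro t ht
  have ht0 : 0 < t := lt_trans (Real.rpow_pos_of_pos hm0 _) ht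
  obtain ⟨s, hs0, hφ, hts⟩ := D.rep t ht0
  have htp : 0 < t ^ p := Real.rpow_pos_of_pos ht0 p
  have hSs : S ≤ s := by
    by_contra hcon
    push Not at hcon
    have h1 := hbd s hs0 hcon.le
    have h2 : (m ^ (-(1 / p))) ^ p < t ^ p :=
      Real.rpow_lt_rpow (Real.rpow_pos_of_pos hm0 _).le ht hp0
    rw [← Real.rpow_mul hm0.le] at h2
    have h3 : -(1 / p) * p = -1 := by field_simp
    rw [h3, Real.rpow_neg_one] at h2
    have h4 : 1 < t ^ p * m := by
      have := mul_lt_mul_of_pos_right h2 hm0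
      rwa [inv_mul_cancel₀ hm0.ne'] at this
    nlinarith
  rw [hφ]
  gcongr

lemma nu_bound {d : ℕ} (hd : 1 ≤ d) (p : ℝ) (hp : 1 ≤ p)
    (ν : EuclideanSpace ℝ (Fin d) → ℝ≥0∞) (hν : Measurable ν)
    (hlevy : ∫⁻ h, ENNReal.ofReal (min 1 (‖h‖ ^ p)) * ν h < ⊤)
    (s ρ : ℝ) (hs : 0 < s)
    (hρ : ρ = (s / (volume (Metric.ball (0 : EuclideanSpace ℝ (Fin d)) 1)).toReal) ^ ((1 : ℝ) / d))
    (hρ1 : ρ ≤ 1) :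
    (nuSharp ν s).toReal * ρ ^ p ≤
      (∫⁻ h, ENNReal.ofReal (min 1 (‖h‖ ^ p)) * ν h).toReal + 1 := by
  have hp0 : 0 < p := by linarith
  have hρ0 : 0 ≤ ρ := by rw [hρ]; positivity
  have hρp : 0 ≤ ρ ^ p := Real.rpow_nonneg hρ0 p
  have h1 := nuSharp_le hd ν hν ρ s hs hρ
  have h2 : ENNReal.ofReal (ρ ^ p) * nuSharp ν s ≤
      ∫⁻ h, ENNReal.ofReal (min 1 (‖h‖ ^ p)) * ν h := by
    calc ENNReal.ofReal (ρ ^ p) * nuSharp ν s ≤ ENNReal.ofReal (ρ ^ p) *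
          ∫⁻ h in (Metric.ball (0 : EuclideanSpace ℝ (Fin d)) ρ)ᶜ, ν h := by gcongr
      _ = ∫⁻ h in (Metric.ball (0 : EuclideanSpace ℝ (Fin d)) ρ)ᶜ,
            ENNReal.ofReal (ρ ^ p) * ν h := (lintegral_const_mul _ hν).symm
      _ ≤ ∫⁻ h in (Metric.ball (0 : EuclideanSpace ℝ (Fin d)) ρ)ᶜ,
            ENNReal.ofReal (min 1 (‖h‖ ^ p)) * ν h := by
          apply setLIntegral_mono' measurableSet_ball.compl
          intro h hh
          have : ρ ≤ ‖h‖ := by simpa using hh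
          gcongr
          apply le_min
          · exact Real.rpow_le_one hρ0 hρ1 hp0.le
          · gcongr
      _ ≤ _ := lintegral_mono' Measure.restrict_le_self le_rfl
  have h3 := ENNReal.toReal_mono hlevy.ne h2
  rw [ENNReal.toReal_mul, ENNReal.toReal_ofReal hρp] at h3
  linarith

lemma case_bad {d : ℕ} (hd : 1 ≤ d) (p : ℝ) (hp : 1 ≤ p)
    (ν : EuclideanSpace ℝ (Fin d) → ℝ≥0∞) (hν : Measurable ν)
    (hlevy : ∫⁻ h, ENNReal.ofReal (min 1 (‖h‖ ^ p)) * ν h < ⊤)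
    (φ : ℝ → ℝ) (hblow : ∀ K : ℝ, 0 < K → ∃ δ > 0, ∀ t, 0 < t → t < δ → K ≤ t ^ d * φ t)
    (hdecay : ∀ S : ℝ, 0 < S → ∃ T > 0, ∀ t, T < t → φ t ≤ 1 / S)
    (Θ : ℝ)
    (hPS : ∀ u : EuclideanSpace ℝ (Fin d) → ℝ, Measurable u →
        luxNorm (volume.restrict (Metric.ball 0 1)) φ u ≠ ⊤ →
        luxNorm (volume.restrict (Metric.ball 0 1)) φ
            (fun x => u x - ⨍ y in Metric.ball 0 1, u y) ≤
          ENNReal.ofReal Θ *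
            (∫⁻ x in Metric.ball 0 1, ∫⁻ y in Metric.ball 0 1,
                ENNReal.ofReal (|u x - u y| ^ p) * ν (x - y)) ^ (1 / p)) : False := by
  have hne : Nonempty (Fin d) := ⟨⟨0, hd⟩⟩
  have hp0 : 0 < p := by linarith
  set i : Fin d := ⟨0, hd⟩ with hi
  set B := Metric.ball (0 : EuclideanSpace ℝ (Fin d)) 1 with hB
  have hBfin : volume B ≠ ⊤ := measure_ball_lt_top.ne
  have hBpos : 0 < volume B := Metric.measure_ball_pos _ _ one_pos
  have hV : 0 < volume.real B := ENNReal.toReal_pos hBpos.ne' hBfin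
  have hcoord : ∀ x : EuclideanSpace ℝ (Fin d), |x i| ≤ ‖x‖ := fun x => by
    simpa using PiLp.norm_apply_le x i
  have hcm : Measurable (fun x : EuclideanSpace ℝ (Fin d) => x i) := by fun_prop
  set u : EuclideanSpace ℝ (Fin d) → ℝ := fun x => 2 + x i with hu
  have hum : Measurable u := by fun_prop
  -- average
  have hint : IntegrableOn (fun x : EuclideanSpace ℝ (Fin d) => x i) B := by
    refine Measure.integrableOn_of_bounded (M := 1) hBfin hcm.aestronglyMeasurable ?_
    filter_upwards [ae_restrict_mem measurableSet_ball] with x hx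
    rw [Real.norm_eq_abs]
    exact (hcoord x).trans (mem_ball_zero_iff.1 hx).le
  have hodd : ∫ x in B, x i = 0 := by
    have h1 := (Measure.measurePreserving_neg (volume : Measure (EuclideanSpace ℝ (Fin d)))).setIntegral_preimage_emb
      (MeasurableEquiv.neg _).measurableEmbedding (fun x => x i) B
    have h2 : Neg.neg ⁻¹' B = B := by ext x; simp [hB]
    rw [h2] at h1
    simp only [PiLp.neg_apply, integral_neg] at h1
    linarith
  have havg : ⨍ y in B, u y = 2 := by
    have hic : IntegrableOn (fun _ : EuclideanSpace ℝ (Fin d) => (2 : ℝ)) B :=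
      integrableOn_const hBfin (by simp)
    rw [setAverage_eq, hu, integral_add hic hint, hodd]
    simp
    field_simp
  -- finiteness
  have hfin : luxNorm (volume.restrict B) φ u ≠ ⊤ := by
    obtain ⟨T, hT, hT2⟩ := hdecay (volume.real B) hV
    have hmem : ENNReal.ofReal (1 / (T + 1)) ∈ {l : ℝ≥0∞ | 0 < l ∧ l ≠ ⊤ ∧
        ∫⁻ x in B, ENNReal.ofReal (φ (|u x| / l.toReal)) ≤ 1} := by
      refine ⟨by positivity, ENNReal.ofReal_ne_top, ?_⟩
      rw [ENNReal.toReal_ofReal (by positivity)]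
      calc ∫⁻ x in B, ENNReal.ofReal (φ (|u x| / (1 / (T + 1)))) ≤
            ∫⁻ x in B, ENNReal.ofReal (1 / volume.real B) := by
            apply setLIntegral_mono' measurableSet_ball
            intro x hx
            apply ENNReal.ofReal_le_ofReal
            apply hT2
            have h1 := (hcoord x).trans (mem_ball_zero_iff.1 hx).le
            have h2 : 1 ≤ |u x| := by
              have := (abs_le.1 h1).1
              refine le_trans ?_ (le_abs_self _)
              simp only [hu]; linarith
            rw [div_div_eq_mul_div, div_one]
            nlinarith
        _ = 1 := by
            rw [setLIntegral_const]
            rw [ENNReal.ofReal_div_of_pos hV, Measure.real, ENNReal.ofReal_toReal hBfin]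
            simp [ENNReal.inv_mul_cancel hBpos.ne' hBfin]
    exact ne_top_of_le_ne_top ENNReal.ofReal_ne_top (sInf_le hmem)
  have hmain := hPS u hum hfin
  rw [havg] at hmain
  -- left side infinite
  have hleft : luxNorm (volume.restrict B) φ (fun x => u x - 2) = ⊤ := by
    unfold luxNorm
    rw [sInf_eq_top]
    rintro l ⟨hl0, hltop, hl⟩
    exfalso
    set r := l.toReal with hr
    have hr0 : 0 < r := ENNReal.toReal_pos hl0.ne' hltop
    obtain ⟨δ₀, hδ0, hδ⟩ := hblow (2 * 4 ^ d / (r ^ d * volume.real B)) (by positivity)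
    set δ := min 1 (δ₀ * r) with hδdef
    have hδp : 0 < δ := by positivity
    have hδ1 : δ ≤ 1 := min_le_left _ _
    have hδr : δ ≤ δ₀ * r := min_le_right _ _
    set z : EuclideanSpace ℝ (Fin d) := EuclideanSpace.single i (δ / 2) with hz
    have hzn : ‖z‖ = δ / 2 := by simp [hz, abs_of_pos hδp]
    have hzi : z i = δ / 2 := by simp [hz]
    have hsub : Metric.ball z (δ / 4) ⊆ B := by
      intro x hx
      rw [mem_ball_iff_norm] at hx
      rw [hB, mem_ball_zero_iff]
      have : ‖x‖ ≤ ‖x - z‖ + ‖z‖ := by simpa using norm_add_le (x - z) z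
      linarith
    have hlow : ∀ x ∈ Metric.ball z (δ / 4), 2 * 4 ^ d / (δ ^ d * volume.real B) ≤
        φ (|u x - 2| / r) := by
      intro x hx
      rw [mem_ball_iff_norm] at hx
      have h1 := abs_le.1 (hcoord (x - z))
      rw [PiLp.sub_apply, hzi] at h1
      have hx1 : 0 < x i := by linarith
      have hx2 : x i < δ := by linarith
      have e1 : |u x - 2| = x i := by simp [hu, abs_of_pos hx1]
      rw [e1]
      set t := x i / r with ht
      have ht0 : 0 < t := by positivity
      have htr : t * r = x i := by rw [ht]; field_simp
      have h2 := hδ t ht0 (by rw [ht, div_lt_iff₀ hr0]; linarith)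
      have h3 : t ^ d * r ^ d ≤ δ ^ d := by
        rw [← mul_pow, htr]; gcongr
      rw [div_le_iff₀ (by positivity)] at h2 ⊢
      have hφ : 0 < φ t := by
        by_contra hcon
        push Not at hcon
        have : t ^ d * φ t * (r ^ d * volume.real B) ≤ 0 :=
          mul_nonpos_of_nonpos_of_nonneg (mul_nonpos_of_nonneg_of_nonpos (by positivity) hcon)
            (by positivity)
        have : (0:ℝ) < 2 * 4 ^ d := by positivity
        linarith
      calc (2 * 4 ^ d : ℝ) ≤ t ^ d * φ t * (r ^ d * volume.real B) := h2
        _ = φ t * ((t ^ d * r ^ d) * volume.real B) := by ring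
        _ ≤ _ := by gcongr
    have hvol : volume (Metric.ball z (δ / 4)) = ENNReal.ofReal ((δ / 4) ^ d * volume.real B) := by
      rw [Measure.addHaar_ball _ _ (by positivity), ENNReal.ofReal_mul (by positivity), Measure.real,
        ENNReal.ofReal_toReal hBfin]
      simp [hB]
    have : (2 : ℝ≥0∞) ≤ 1 := by
      calc (2 : ℝ≥0∞) = ENNReal.ofReal (2 * 4 ^ d / (δ ^ d * volume.real B)) *
            volume (Metric.ball z (δ / 4)) := by
            rw [hvol, ← ENNReal.ofReal_mul (by positivity)]
            have : 2 * 4 ^ d / (δ ^ d * volume.real B) * ((δ / 4) ^ d * volume.real B) = 2 := by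
              rw [div_pow]; field_simp
            rw [this]; simp
        _ = ∫⁻ x in Metric.ball z (δ / 4),
              ENNReal.ofReal (2 * 4 ^ d / (δ ^ d * volume.real B)) := by rw [setLIntegral_const]
        _ ≤ ∫⁻ x in Metric.ball z (δ / 4), ENNReal.ofReal (φ (|u x - 2| / r)) := by
            apply setLIntegral_mono' measurableSet_ball
            intro x hx
            exact ENNReal.ofReal_le_ofReal (hlow x hx)
        _ ≤ ∫⁻ x in B, ENNReal.ofReal (φ (|u x - 2| / r)) := lintegral_mono_set hsub
        _ ≤ 1 := hl
    norm_num at this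
  rw [hleft, top_le_iff] at hmain
  -- right side finite
  have hE : (∫⁻ x in B, ∫⁻ y in B, ENNReal.ofReal (|u x - u y| ^ p) * ν (x - y)) ≠ ⊤ := by
    set J := ∫⁻ h, ENNReal.ofReal (min 1 (‖h‖ ^ p)) * ν h with hJ
    have hin : ∀ x ∈ B, ∫⁻ y in B, ENNReal.ofReal (|u x - u y| ^ p) * ν (x - y) ≤
        ENNReal.ofReal (2 ^ p) * J := by
      intro x hx
      calc ∫⁻ y in B, ENNReal.ofReal (|u x - u y| ^ p) * ν (x - y) ≤
            ∫⁻ y in B, ENNReal.ofReal (2 ^ p) *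
              (ENNReal.ofReal (min 1 (‖x - y‖ ^ p)) * ν (x - y)) := by
            apply setLIntegral_mono' measurableSet_ball
            intro y hy
            rw [← mul_assoc, ← ENNReal.ofReal_mul (by positivity)]
            gcongr
            have h1 : |u x - u y| ≤ ‖x - y‖ := by
              have := hcoord (x - y)
              simpa [hu] using this
            have h2 : ‖x - y‖ ≤ 2 := by
              have := norm_sub_le x y
              have := mem_ball_zero_iff.1 hx
              have := mem_ball_zero_iff.1 hy
              linarith
            have h3 : |u x - u y| ^ p ≤ ‖x - y‖ ^ p := by gcongr
            have h4 : ‖x - y‖ ^ p ≤ 2 ^ p := by gcongr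
            have h5 : (1:ℝ) ≤ 2 ^ p := Real.one_le_rpow (by norm_num) hp0.le
            have h6 : 0 ≤ ‖x - y‖ ^ p := by positivity
            rcases min_cases 1 (‖x - y‖ ^ p) with h | h
            · rw [h.1]; linarith
            · rw [h.1]; nlinarith
        _ ≤ ∫⁻ y, ENNReal.ofReal (2 ^ p) *
              (ENNReal.ofReal (min 1 (‖x - y‖ ^ p)) * ν (x - y)) :=
            lintegral_mono' Measure.restrict_le_self le_rfl
        _ = ∫⁻ h, ENNReal.ofReal (2 ^ p) * (ENNReal.ofReal (min 1 (‖h‖ ^ p)) * ν h) :=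
            lintegral_sub_left_eq_self
              (fun h => ENNReal.ofReal (2 ^ p) * (ENNReal.ofReal (min 1 (‖h‖ ^ p)) * ν h)) x
        _ = _ := lintegral_const_mul' _ _ ENNReal.ofReal_ne_top
    have : (∫⁻ x in B, ∫⁻ y in B, ENNReal.ofReal (|u x - u y| ^ p) * ν (x - y)) ≤
        ENNReal.ofReal (2 ^ p) * J * volume B := by
      rw [← setLIntegral_const]
      exact setLIntegral_mono' measurableSet_ball hin
    exact ne_top_of_le_ne_top
      (ENNReal.mul_ne_top (ENNReal.mul_ne_top ENNReal.ofReal_ne_top hlevy.ne) hBfin) this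
  exact ENNReal.mul_ne_top ENNReal.ofReal_ne_top
    (ENNReal.rpow_ne_top_of_nonneg (by positivity) hE) hmain


/-- if the Poincaré–Sobolev inequality holds on every ball with a universal
constant `Θ`, then the global Gagliardo–Nirenberg–Sobolev inequality holds with the same
constant. -/
theorem stmt_19 {d : ℕ} (hd : 1 ≤ d) (p : ℝ) (hp : 1 ≤ p)
    (ν : EuclideanSpace ℝ (Fin d) → ℝ≥0∞) (hν : Measurable ν)
    (hlevy : ∫⁻ h, ENNReal.ofReal (min 1 (‖h‖ ^ p)) * ν h < ⊤)
    (hw : Set.BijOn (wFn ν p) (Set.Ici 0) (Set.Ici 0))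
    (Θ : ℝ) (hΘ : 0 < Θ)
    (hPS : ∀ (z : EuclideanSpace ℝ (Fin d)) (r : ℝ), 0 < r →
      ∀ u : EuclideanSpace ℝ (Fin d) → ℝ, Measurable u →
        luxNorm (volume.restrict (Metric.ball z r)) (critFn ν p) u ≠ ⊤ →
        luxNorm (volume.restrict (Metric.ball z r)) (critFn ν p)
            (fun x => u x - ⨍ y in Metric.ball z r, u y) ≤
          ENNReal.ofReal Θ *
            (∫⁻ x in Metric.ball z r, ∫⁻ y in Metric.ball z r,
                ENNReal.ofReal (|u x - u y| ^ p) * ν (x - y)) ^ (1 / p)) :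
    ∀ u : EuclideanSpace ℝ (Fin d) → ℝ, Measurable u →
      luxNorm volume (critFn ν p) u ≠ ⊤ →
      luxNorm volume (critFn ν p) u ≤
        ENNReal.ofReal Θ *
          (∫⁻ x, ∫⁻ y, ENNReal.ofReal (|u x - u y| ^ p) * ν (x - y)) ^ (1 / p) := by
  have hpos : (0 : ℝ) < (volume (Metric.ball (0 : EuclideanSpace ℝ (Fin d)) 1)).toReal :=
    ENNReal.toReal_pos (Metric.measure_ball_pos _ _ one_pos).ne' measure_ball_lt_top.ne
  have D := critData p hp ν hw
  by_cases hm : ∀ a b, 0 < a → a < b → a * (nuSharp ν a).toReal < b * (nuSharp ν b).toReal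
  · intro u hu hfin
    exact case_mono hd p hp ν _ (fun t ht => D.phi_pos ht) D.zero (D.ratio hp hm) Θ u hu
      (fun z r hr h => hPS z r hr u hu h) hfin
  · exfalso
    push Not at hm
    obtain ⟨a, b, ha, hab, hle⟩ := hm
    have hlt : b * (nuSharp ν b).toReal < a * (nuSharp ν a).toReal := by
      refine lt_of_le_of_ne hle fun h => hab.ne' ?_
      exact D.inj b a (ha.trans hab) ha h
    exact case_bad hd p hp ν hν hlevy (critFn ν p)
      (fun K hK => D.blowup hp a b ha hab hlt hd _ _ hpos
        (by positivity) (fun s ρ hs hρ hρ1 => nu_bound hd p hp ν hν hlevy s ρ hs hρ hρ1) K hK)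
      (fun S hS => D.decay hp a b ha hab hlt S hS) Θ (fun u hu h => hPS 0 1 one_pos u hu h)
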